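/- arXiv:1605.04510 — 4 statements merged into one kernel-verified Lean document; each statement's English description precedes it below -/
import Mathlib

section
/- Let L ≥ 2 and let S_1, ..., S_L be finite sets (MU sets) each of cardinality n, with k ≤ n. If for every pair of distinct indices i ≠ j the pairwise intersection satisfies (L − 1)·|S_i ∩ S_j| ≤ 2(n − k), then there exists a full-throughput solution, i.e., there exist pairwise disjoint subsets S'_1, ..., S'_L with S'_i ⊆ S_i and |S'_i| = k for every i. -/
/-- Hall's theorem with multiplicity: if every subfamily `I` covers at least `k * |I|` points,
then pairwise disjoint `k`-element subsets can be chosen. -/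
theorem exists_disjoint_subsets_card_eq_of_hall {ι α : Type*} [DecidableEq α] {k : ℕ}
    (S : ι → Finset α) (h : ∀ I : Finset ι, I.card * k ≤ (I.biUnion S).card) :
    ∃ S' : ι → Finset α, (∀ i, S' i ⊆ S i) ∧ (∀ i, (S' i).card = k) ∧
      ∀ i j, i ≠ j → Disjoint (S' i) (S' j) := by
  classical
  obtain ⟨f, hf, hfS⟩ := (Finset.all_card_le_biUnion_card_iff_exists_injective
    (fun p : ι × Fin k ↦ S p.1)).1 fun s ↦ by
      calc s.card ≤ (s.image Prod.fst ×ˢ (Finset.univ : Finset (Fin k))).card :=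
            Finset.card_le_card fun p hp ↦ by
              simpa using ⟨p.2, hp⟩
        _ = (s.image Prod.fst).card * k := by simp
        _ ≤ ((s.image Prod.fst).biUnion S).card := h _
        _ = (s.biUnion fun p ↦ S p.1).card := by rw [Finset.image_biUnion]
  refine ⟨fun i ↦ Finset.univ.image fun a : Fin k ↦ f (i, a), fun i ↦ ?_, fun i ↦ ?_,
    fun i j hij ↦ ?_⟩
  · simpa [Finset.image_subset_iff] using fun a ↦ hfS (i, a)
  · exact (Finset.card_image_of_injective _ (hf.comp (Prod.mk_right_injective i))).trans
      (Finset.card_fin k)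
  · simp only [Finset.disjoint_left, Finset.mem_image, Finset.mem_univ, true_and]
    rintro _ ⟨a, rfl⟩ ⟨b, hb⟩
    exact hij (congrArg Prod.fst (hf hb)).symm

/-- A Bonferroni-type lower bound for the size of a union of sets with small pairwise
intersections. -/
theorem two_mul_sum_card_le_card_biUnion_add {ι α : Type*} [DecidableEq α] {t : ℕ}
    (S : ι → Finset α) (h : ∀ i j, i ≠ j → (S i ∩ S j).card ≤ t) (I : Finset ι) :
    2 * ∑ i ∈ I, (S i).card ≤ 2 * (I.biUnion S).card + I.card * (I.card - 1) * t := by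
  classical
  induction I using Finset.induction_on with
  | empty => simp
  | insert a I ha ih =>
    have hinter : (S a ∩ I.biUnion S).card ≤ I.card * t := by
      rw [Finset.inter_biUnion]
      exact Finset.card_biUnion_le_card_mul _ _ _ fun i hi ↦
        h a i fun hai ↦ ha (hai ▸ hi)
    have hunion := Finset.card_union_add_card_inter (S a) (I.biUnion S)
    rw [Finset.sum_insert ha, Finset.biUnion_insert, Finset.card_insert_of_notMem ha,
      Nat.add_sub_cancel]
    obtain hI | ⟨m, hm⟩ : I.card = 0 ∨ ∃ m, I.card = m + 1 := by
      cases I.card <;> simp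
    · simp only [hI, zero_mul] at *
      lia
    · simp only [hm, Nat.add_sub_cancel] at *
      nlinarith


/-- Theorem 3 (pairwise condition): if every pairwise intersection of the `L ≥ 2`
MU sets (each of cardinality `n`, `k ≤ n`) satisfies `(L-1)·|Sᵢ ∩ Sⱼ| ≤ 2(n-k)`,
then a full-throughput solution exists. -/
theorem pairwise_condition_full_throughput
    {α : Type*} [DecidableEq α] {L n k : ℕ} (hL : 2 ≤ L) (hkn : k ≤ n)
    (S : Fin L → Finset α) (hcard : ∀ i, (S i).card = n)
    (hpair : ∀ i j : Fin L, i ≠ j → (L - 1) * ((S i) ∩ (S j)).card ≤ 2 * (n - k)) :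
    ∃ S' : Fin L → Finset α,
      (∀ i, S' i ⊆ S i) ∧ (∀ i, (S' i).card = k) ∧
      (∀ i j : Fin L, i ≠ j → Disjoint (S' i) (S' j)) := by
  have hL' : 0 < L - 1 := by lia
  refine exists_disjoint_subsets_card_eq_of_hall S fun I ↦ ?_
  have hbonf := two_mul_sum_card_le_card_biUnion_add (t := 2 * (n - k) / (L - 1)) S
    (fun i j hij ↦ (Nat.le_div_iff_mul_le hL').2 (mul_comm (L - 1) _ ▸ hpair i j hij)) I
  have hI : I.card - 1 ≤ L - 1 := Nat.sub_le_sub_right (card_finset_fin_le I) 1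
  have hloss : I.card * (I.card - 1) * (2 * (n - k) / (L - 1)) ≤ I.card * (2 * (n - k)) := by
    rw [mul_assoc]
    exact Nat.mul_le_mul_left _ ((Nat.mul_le_mul_right _ hI).trans (Nat.mul_div_le _ _))
  simp only [hcard, Finset.sum_const, smul_eq_mul] at hbonf
  obtain ⟨d, rfl⟩ := Nat.exists_eq_add_of_le hkn
  rw [Nat.add_sub_cancel_left] at hbonf hloss
  nlinarith
end

section
/- Let L ≥ 2 and let S_1, ..., S_L be finite sets (MU sets) each of cardinality n, with k ≤ n, such that for every pair of distinct indices i ≠ j, (L − 1)·|S_i ∩ S_j| ≤ 2(n − k). Then there exist pairwise disjoint subsets S'_1, ..., S'_L with S'_i ⊆ S_i and |S'_i| = k for every i, such that moreover every element of every S'_i belongs to at most two of the sets S_1, ..., S_L. -/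
open Finset in
/-- A `k`-fold Hall theorem: pairwise disjoint `k`-element subsets of the sets `t i` exist as soon
as any family of `m` of these sets covers at least `m * k` elements. -/
theorem exists_pairwise_disjoint_subsets_card_eq {ι α : Type*} [DecidableEq ι] [DecidableEq α]
    {k : ℕ} (t : ι → Finset α) (h : ∀ s : Finset ι, #s * k ≤ #(s.biUnion t)) :
    ∃ u : ι → Finset α, (∀ i, u i ⊆ t i) ∧ (∀ i, #(u i) = k) ∧
      ∀ i j, i ≠ j → Disjoint (u i) (u j) := by
  obtain ⟨f, hf, hft⟩ := (all_card_le_biUnion_card_iff_exists_injective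
    (fun p : ι × Fin k => t p.1)).mp fun s => by
      calc #s ≤ #(s.image Prod.fst ×ˢ (univ : Finset (Fin k))) :=
            card_le_card fun p hp => by
              simp only [mem_product, mem_univ, and_true]
              exact mem_image_of_mem _ hp
        _ = #(s.image Prod.fst) * k := by simp
        _ ≤ #((s.image Prod.fst).biUnion t) := h _
        _ = #(s.biUnion fun p => t p.1) := by rw [image_biUnion]
  refine ⟨fun i => univ.image fun a => f (i, a), fun i => ?_, fun i => ?_, fun i j hij => ?_⟩
  · simpa [image_subset_iff] using fun a => hft (i, a)
  · rw [card_image_of_injective _ fun a b hab => by simpa using hf hab]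
    simp
  · rw [disjoint_left]
    intro x hx hy
    obtain ⟨a, -, rfl⟩ := mem_image.mp hx
    obtain ⟨b, -, hb⟩ := mem_image.mp hy
    exact hij (congrArg Prod.fst (hf hb)).symm

open Finset in
/-- Double counting of the pairs `(x, j)` with `x ∈ S i ∩ S j` and `j ≠ i`. -/
theorem sum_card_filter_mem_sub_one {ι α : Type*} [Fintype ι] [DecidableEq ι] [DecidableEq α]
    (S : ι → Finset α) (i : ι) :
    ∑ x ∈ S i, (#{j | x ∈ S j} - 1) = ∑ j ∈ univ.erase i, #(S i ∩ S j) := by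
  have h : ∀ x ∈ S i, #{j | x ∈ S j} - 1 = #{j ∈ univ.erase i | x ∈ S j} := fun x hx => by
    rw [filter_erase, card_erase_of_mem (by simpa using hx)]
  rw [sum_congr rfl h]
  simp_rw [← filter_mem_eq_inter]
  exact sum_card_bipartiteAbove_eq_sum_card_bipartiteBelow (fun x j => x ∈ S j)

open Finset in
/-- If every set `S i` has weight at least `2 * k`, where an element contained in exactly `d` of the
sets has weight `3 - d` (truncated), then the elements contained in at most two of the sets satisfy
the `k`-fold Hall condition. -/
theorem card_mul_le_card_biUnion_filter {ι α : Type*} [Fintype ι] [DecidableEq α]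
    {k : ℕ} (S : ι → Finset α) (h : ∀ i, 2 * k ≤ ∑ x ∈ S i, (3 - #{j | x ∈ S j}))
    (s : Finset ι) :
    #s * k ≤ #(s.biUnion fun i => {x ∈ S i | #{j | x ∈ S j} ≤ 2}) := by
  set U := s.biUnion fun i => {x ∈ S i | #{j | x ∈ S j} ≤ 2} with hU
  have hsum : ∀ i ∈ s, ∑ x ∈ S i, (3 - #{j | x ∈ S j}) ≤
      ∑ x ∈ U, if x ∈ S i then 3 - #{j | x ∈ S j} else 0 := fun i hi => by
    rw [← sum_filter]
    refine sum_le_sum_of_ne_zero fun x hx hne => ?_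
    rw [mem_filter, hU, mem_biUnion]
    exact ⟨⟨i, hi, mem_filter.mpr ⟨hx, by omega⟩⟩, hx⟩
  have hweight : ∀ x ∈ U, (∑ i ∈ s, if x ∈ S i then 3 - #{j | x ∈ S j} else 0) ≤ 2 :=
    fun x _ => by
      rw [← sum_filter, sum_const, smul_eq_mul]
      have hle : #{i ∈ s | x ∈ S i} ≤ #{j | x ∈ S j} :=
        card_le_card (filter_subset_filter _ (subset_univ s))
      refine (Nat.mul_le_mul_right _ hle).trans ?_
      generalize #{j | x ∈ S j} = d
      rcases le_or_gt d 3 with hd | hd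
      · interval_cases d <;> simp
      · simp [Nat.sub_eq_zero_of_le hd.le]
  have key : #s * (2 * k) ≤ #U * 2 :=
    calc #s * (2 * k) ≤ ∑ i ∈ s, ∑ x ∈ S i, (3 - #{j | x ∈ S j}) := by
          simpa using card_nsmul_le_sum s _ (2 * k) fun i _ => h i
      _ ≤ ∑ i ∈ s, ∑ x ∈ U, if x ∈ S i then 3 - #{j | x ∈ S j} else 0 := sum_le_sum hsum
      _ = ∑ x ∈ U, ∑ i ∈ s, if x ∈ S i then 3 - #{j | x ∈ S j} else 0 := sum_comm
      _ ≤ #U * 2 := by simpa using sum_le_card_nsmul U _ 2 hweight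
  linarith

/-- Under the pairwise condition, a full-throughput solution exists that uses only
memory units contained in at most two of the MU sets. -/
theorem pairwise_condition_full_throughput_design
    {α : Type*} [DecidableEq α] {L n k : ℕ} (hL : 2 ≤ L) (hkn : k ≤ n)
    (S : Fin L → Finset α) (hcard : ∀ i, (S i).card = n)
    (hpair : ∀ i j : Fin L, i ≠ j → (L - 1) * ((S i) ∩ (S j)).card ≤ 2 * (n - k)) :
    ∃ S' : Fin L → Finset α,
      (∀ i, S' i ⊆ S i) ∧ (∀ i, (S' i).card = k) ∧
      (∀ i j : Fin L, i ≠ j → Disjoint (S' i) (S' j)) ∧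
      (∀ i, ∀ x ∈ S' i, (Finset.univ.filter (fun j : Fin L => x ∈ S j)).card ≤ 2) := by
  have hweight : ∀ i, 2 * k ≤ ∑ x ∈ S i, (3 - (Finset.univ.filter (x ∈ S ·)).card) := fun i => by
    have hpairs : ∑ x ∈ S i, ((Finset.univ.filter (x ∈ S ·)).card - 1) ≤ 2 * (n - k) := by
      rw [sum_card_filter_mem_sub_one]
      refine Nat.le_of_mul_le_mul_left (c := L - 1) ?_ (by omega)
      rw [Finset.mul_sum]
      simpa using Finset.sum_le_card_nsmul (Finset.univ.erase i) _ (2 * (n - k))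
        fun j hj => hpair i j (Finset.ne_of_mem_erase hj).symm
    have htotal : (S i).card * 2 ≤ ∑ x ∈ S i, ((3 - (Finset.univ.filter (x ∈ S ·)).card) +
        ((Finset.univ.filter (x ∈ S ·)).card - 1)) :=
      Finset.card_nsmul_le_sum (S i) _ 2 fun x _ => by omega
    rw [Finset.sum_add_distrib, hcard] at htotal
    omega
  obtain ⟨S', hsub, hcard', hdisj⟩ :=
    exists_pairwise_disjoint_subsets_card_eq _ (card_mul_le_card_biUnion_filter S hweight)
  exact ⟨S', fun i => (hsub i).trans (Finset.filter_subset _ _), hcard', hdisj,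
    fun i x hx => (Finset.mem_filter.mp (hsub i hx)).2⟩
end

section
/- Let N, n, k be integers with k ≤ n ≤ N, let a_1, ..., a_L ∈ ZMod N, and set S_i = arc(a_i, n) for i = 1, ..., L. Suppose that for an index set T ⊆ {1, ..., L} there exist pairwise disjoint subsets S'_i ⊆ S_i (i ∈ T) with |S'_i| = k. Then there also exist pairwise disjoint subsets S''_i ⊆ S_i (i ∈ T) with |S''_i| = k such that each S''_i is itself a cyclic arc of length k, i.e., S''_i = arc(b_i, k) for some b_i ∈ ZMod N with arc(b_i, k) ⊆ arc(a_i, n). -/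
/-- The cyclic arc of length `m` starting at `a` in `ZMod N`. -/
def arc (N : ℕ) (a : ZMod N) (m : ℕ) : Finset (ZMod N) :=
  (Finset.range m).image (fun i : ℕ => (a + (i : ZMod N) : ZMod N))

theorem mem_arc_intCast {N : ℕ} {z : ℤ} {m : ℕ} {x : ZMod N} :
    x ∈ arc N (z : ZMod N) m ↔ ∃ y : ℤ, z ≤ y ∧ y < z + m ∧ (y : ZMod N) = x := by
  simp only [arc, Finset.mem_image, Finset.mem_range]
  constructor
  · rintro ⟨u, hu, rfl⟩
    exact ⟨z + u, by omega, by omega, by push_cast; rfl⟩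
  · rintro ⟨y, h1, h2, rfl⟩
    refine ⟨(y - z).toNat, by omega, ?_⟩
    have h : ((y - z).toNat : ℤ) = y - z := by omega
    rw [← Int.cast_natCast (R := ZMod N), h]
    push_cast
    ring

/-- Integers in a window of length at most `N` which are congruent mod `N` are equal. -/
theorem eq_of_intCast_eq_of_window {N n : ℕ} (hnN : n ≤ N) {z x y : ℤ}
    (hx : z ≤ x) (hx' : x < z + n) (hy : z ≤ y) (hy' : y < z + n)
    (h : (x : ZMod N) = y) : x = y := by
  rw [ZMod.intCast_eq_intCast_iff_dvd_sub] at h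
  have := Int.eq_zero_of_abs_lt_dvd h (abs_lt.2 ⟨by omega, by omega⟩)
  omega

/-- The integers of the window `[z, z + n)` lying over a subset of the arc of length `n` at `z`
are as many as the elements of that subset. -/
theorem card_filter_intCast_mem {N n : ℕ} (hnN : n ≤ N) (z : ℤ) (S : Finset (ZMod N))
    (hS : S ⊆ arc N (z : ZMod N) n) :
    ((Finset.Ico z (z + n)).filter (fun x : ℤ => (x : ZMod N) ∈ S)).card = S.card := by
  refine Finset.card_bij (fun x _ => (x : ZMod N)) ?_ ?_ ?_
  · intro x hx
    exact (Finset.mem_filter.1 hx).2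
  · intro x hx y hy h
    simp only [Finset.mem_filter, Finset.mem_Ico] at hx hy
    exact eq_of_intCast_eq_of_window hnN hx.1.1 hx.1.2 hy.1.1 hy.1.2 h
  · intro x hx
    obtain ⟨y, h1, h2, rfl⟩ := mem_arc_intCast.1 (hS hx)
    exact ⟨y, by simp [h1, h2, hx], rfl⟩

/-- A finite family of points of `[0, N)`, extended `N`-periodically to `ℤ`, can be enumerated
monotonically by `ℤ`, with the index set of the family enumerated periodically. -/
theorem exists_monotone_periodic_enumeration {ι : Type*} (T : Finset ι) (hT : T.Nonempty)
    (N : ℤ) (f : ι → ℤ) (h0 : ∀ i ∈ T, 0 ≤ f i) (hN : ∀ i ∈ T, f i < N) :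
    ∃ (M : ℤ) (g : ℤ → ι) (r : ℤ → ℤ), Monotone r ∧ (∀ j, g j ∈ T) ∧
      (∀ i ∈ T, ∃ j, g j = i) ∧ (∀ j, ∃ t, r j = f (g j) + N * t) ∧
      (∀ j t, r (j + M * t) = r j + N * t) ∧ (∀ j t, g (j + M * t) = g j) ∧
      (∀ i j, g i = g j → ∃ t, i = j + M * t) := by
  obtain ⟨m, hM, e, hmono, hinj, he, hsurj⟩ : ∃ m : ℕ, (0 : ℤ) < m ∧ ∃ e : Fin m → ι,
      Monotone (f ∘ e) ∧ Function.Injective e ∧ (∀ p, e p ∈ T) ∧ ∀ i ∈ T, ∃ p, e p = i := by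
    let φ : Fin T.card → ι := fun p => (T.equivFin.symm p : ι)
    let σ := Tuple.sort (f ∘ φ)
    exact ⟨T.card, by exact_mod_cast hT.card_pos, φ ∘ σ, Tuple.monotone_sort (f ∘ φ),
      (Subtype.val_injective.comp T.equivFin.symm.injective).comp σ.injective,
      fun p => (T.equivFin.symm (σ p)).2,
      fun i hi => ⟨σ.symm (T.equivFin ⟨i, hi⟩), by simp [φ]⟩⟩
  have hlt : ∀ j : ℤ, (j % m).toNat < m := fun j => by
    have := Int.emod_lt_of_pos j hM
    omega
  let c : ℤ → Fin m := fun j => ⟨(j % m).toNat, hlt j⟩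
  have hc : ∀ j t, c (j + m * t) = c j := fun j t => by simp [c]
  refine ⟨m, fun j => e (c j), fun j => f (e (c j)) + N * (j / m), ?_, fun j => he _, ?_,
    fun j => ⟨_, rfl⟩, ?_, ?_, ?_⟩
  · intro i j hij
    have hdiv : i / m ≤ j / m := Int.ediv_le_ediv hM hij
    rcases hdiv.eq_or_lt with heq | hlt'
    · have hle : c i ≤ c j := by
        have h1 := Int.emod_add_mul_ediv i m
        have h2 := Int.emod_add_mul_ediv j m
        rw [heq] at h1
        exact Int.toNat_le_toNat (by omega)
      have := hmono hle
      simp only [Function.comp_apply] at this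
      simp only [heq]
      omega
    · have h1 := hN _ (he (c i))
      have h2 := h0 _ (he (c j))
      have h3 := h0 _ (he (c i))
      have : N * (i / m + 1) ≤ N * (j / m) :=
        mul_le_mul_of_nonneg_left hlt' (by omega)
      simp only
      linarith
  · intro i hi
    obtain ⟨p, rfl⟩ := hsurj i hi
    refine ⟨(p : ℕ), congrArg e (Fin.ext ?_)⟩
    have : ((p : ℕ) : ℤ) % m = (p : ℕ) := Int.emod_eq_of_lt (by omega) (by omega)
    simp only [c, this, Int.toNat_natCast]
  · intro j t
    simp only [hc, Int.add_mul_ediv_left _ _ hM.ne']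
    ring
  · intro j t
    simp only [hc]
  · intro i j h
    have h1 : (i % m).toNat = (j % m).toNat := congrArg Fin.val (hinj h)
    have h2 := Int.emod_nonneg i hM.ne'
    have h3 := Int.emod_nonneg j hM.ne'
    refine ⟨i / m - j / m, ?_⟩
    have h4 := Int.emod_add_mul_ediv i m
    have h5 := Int.emod_add_mul_ediv j m
    have h6 : i % m = j % m := by omega
    linear_combination h5 - h4 + h6

/-- First-come-first-served scheduling: release times `r`, windows of length `n`, jobs of
length `k`. Under the counting condition `hall`, the earliest start times meet all deadlines,
and they inherit the periodicity of `r`. -/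
theorem exists_periodic_schedule (r : ℤ → ℤ) (M N n k : ℤ)
    (hper : ∀ j t, r (j + M * t) = r j + N * t)
    (hall : ∀ (j : ℤ) (m : ℕ), r (j - m) + (m + 1) * k ≤ r j + n) :
    ∃ s : ℤ → ℤ, (∀ j, r j ≤ s j) ∧ (∀ j, s j + k ≤ r j + n) ∧ (∀ j, s j + k ≤ s (j + 1)) ∧
      (∀ j t, s (j + M * t) = s j + N * t) := by
  have hbdd : ∀ j, BddAbove (Set.range fun m : ℕ => r (j - m) + m * k) := by
    refine fun j => ⟨r j + n - k, ?_⟩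
    rintro _ ⟨m, rfl⟩
    linarith [hall j m]
  let s : ℤ → ℤ := fun j => ⨆ m : ℕ, (r (j - m) + m * k)
  have hle : ∀ j (m : ℕ), r (j - m) + m * k ≤ s j := fun j m => le_ciSup (hbdd j) m
  have hshift : ∀ j t, s (j + M * t) ≤ s j + N * t := by
    refine fun j t => ciSup_le fun m => ?_
    have h := hper (j - m) t
    rw [show j - m + M * t = j + M * t - m by ring] at h
    linarith [hle j m]
  refine ⟨s, fun j => by simpa using hle j 0, fun j => ?_, fun j => ?_, fun j t => ?_⟩
  · have : s j ≤ r j + n - k := ciSup_le fun m => by linarith [hall j m]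
    linarith
  · have : s j ≤ s (j + 1) - k := ciSup_le fun m => by
      have h := hle (j + 1) (m + 1)
      rw [show j + 1 - ((m + 1 : ℕ) : ℤ) = j - m by push_cast; ring] at h
      push_cast at h
      linarith
    linarith
  · refine le_antisymm (hshift j t) ?_
    have h := hshift (j + M * t) (-t)
    rw [show j + M * t + M * -t = j by ring] at h
    linarith

/-- If pairwise disjoint `k`-sets `U j` lie in windows `[r j, r j + n)` with `r` monotone, then
consecutive windows jointly have room for their sets. -/
theorem add_mul_le_of_pairwise_disjoint (r : ℤ → ℤ) (hr : Monotone r) (n k : ℕ)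
    (U : ℤ → Finset ℤ) (hU : ∀ j, U j ⊆ Finset.Ico (r j) (r j + n))
    (hcard : ∀ j, (U j).card = k) (hdisj : ∀ i j, i ≠ j → Disjoint (U i) (U j))
    (j : ℤ) (m : ℕ) : r (j - m) + (m + 1) * k ≤ r j + n := by
  have hsub : (Finset.Icc (j - m) j).biUnion U ⊆ Finset.Ico (r (j - m)) (r j + n) := by
    intro x hx
    obtain ⟨i, hi, hx⟩ := Finset.mem_biUnion.1 hx
    have h1 := Finset.mem_Icc.1 hi
    have h2 := Finset.mem_Ico.1 (hU i hx)
    have h3 := hr h1.1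
    have h4 := hr h1.2
    exact Finset.mem_Ico.2 ⟨by omega, by omega⟩
  have h := Finset.card_le_card hsub
  rw [Finset.card_biUnion fun i _ i' _ hne => hdisj i i' hne] at h
  simp only [hcard, Finset.sum_const, Int.card_Icc, Int.card_Ico, smul_eq_mul] at h
  rw [show (j + 1 - (j - m)).toNat = m + 1 by omega] at h
  have hmono : r (j - m) ≤ r j := hr (by omega)
  zify at h
  rw [Int.toNat_of_nonneg (by omega)] at h
  linarith

/-- Intervals of length `k` whose starting points are `k`-separated in order are disjoint. -/
theorem eq_of_mem_separated_intervals {s : ℤ → ℤ} {k : ℤ}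
    (hs : ∀ j, s j + k ≤ s (j + 1)) {i j x : ℤ} (hi : s i ≤ x) (hi' : x < s i + k)
    (hj : s j ≤ x) (hj' : x < s j + k) : i = j := by
  have hmono : Monotone s := monotone_int_of_le_succ fun j => by linarith [hs j]
  rcases lt_trichotomy i j with h | h | h
  · linarith [hs i, hmono (show i + 1 ≤ j from h)]
  · exact h
  · linarith [hs j, hmono (show j + 1 ≤ i from h)]

/-- Lemma 1: in the cyclic placement, any solution assigning disjoint `k`-subsets of the
length-`n` arcs to the packets in `T` can be converted into one where each assigned
`k`-subset is itself a cyclic arc of length `k` contained in the packet's arc. -/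
theorem cyclic_consecutive_solution
    {N n k L : ℕ} (hkn : k ≤ n) (hnN : n ≤ N)
    (a : Fin L → ZMod N) (T : Finset (Fin L))
    (S' : Fin L → Finset (ZMod N))
    (hsub : ∀ i ∈ T, S' i ⊆ arc N (a i) n)
    (hcard : ∀ i ∈ T, (S' i).card = k)
    (hdisj : ∀ i ∈ T, ∀ j ∈ T, i ≠ j → Disjoint (S' i) (S' j)) :
    ∃ b : Fin L → ZMod N,
      (∀ i ∈ T, arc N (b i) k ⊆ arc N (a i) n) ∧
      (∀ i ∈ T, ∀ j ∈ T, i ≠ j → Disjoint (arc N (b i) k) (arc N (b j) k)) := by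
  rcases Nat.eq_zero_or_pos N with rfl | hNpos
  · obtain rfl : n = 0 := by omega
    obtain rfl : k = 0 := by omega
    exact ⟨a, by simp [arc], by simp [arc]⟩
  rcases T.eq_empty_or_nonempty with rfl | hT
  · exact ⟨a, by simp, by simp⟩
  have : NeZero N := ⟨hNpos.ne'⟩
  obtain ⟨M, g, r, hr, hgT, hgsurj, hrf, hrper, hgper, hginj⟩ :=
    exists_monotone_periodic_enumeration T hT N (fun i => ((a i).val : ℤ))
      (fun i _ => by positivity) (fun i _ => by exact_mod_cast ZMod.val_lt (a i))
  have hra : ∀ j, ((r j : ℤ) : ZMod N) = a (g j) := by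
    intro j
    obtain ⟨t, ht⟩ := hrf j
    simp [ht]
  let U : ℤ → Finset ℤ := fun j =>
    (Finset.Ico (r j) (r j + n)).filter (fun x : ℤ => (x : ZMod N) ∈ S' (g j))
  have hUcard : ∀ j, (U j).card = k := fun j =>
    (card_filter_intCast_mem hnN (r j) (S' (g j)) (by rw [hra]; exact hsub _ (hgT j))).trans
      (hcard _ (hgT j))
  have hUdisj : ∀ i j, i ≠ j → Disjoint (U i) (U j) := by
    intro i j hij
    rw [Finset.disjoint_left]
    intro x hxi hxj
    simp only [U, Finset.mem_filter, Finset.mem_Ico] at hxi hxj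
    have hg : g i = g j := by
      by_contra hne
      exact Finset.disjoint_left.1 (hdisj _ (hgT i) _ (hgT j) hne) hxi.2 hxj.2
    obtain ⟨t, rfl⟩ := hginj i j hg
    have h := hrper j t
    have ht : (N : ℤ) * t = 0 :=
      Int.eq_zero_of_abs_lt_dvd (dvd_mul_right _ _) (abs_lt.2 ⟨by omega, by omega⟩)
    rcases mul_eq_zero.1 ht with h0 | rfl
    · omega
    · simp at hij
  obtain ⟨s, hrs, hsd, hsep, hsper⟩ := exists_periodic_schedule r M N n k hrper
    (add_mul_le_of_pairwise_disjoint r hr n k U (fun j => Finset.filter_subset _ _)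
      hUcard hUdisj)
  choose! c hc using hgsurj
  refine ⟨fun i => (s (c i) : ZMod N), fun i hi x hx => ?_, fun i hi j hj hij => ?_⟩
  · obtain ⟨y, h1, h2, rfl⟩ := mem_arc_intCast.1 hx
    rw [← hc i hi, ← hra]
    have h3 := hrs (c i)
    have h4 := hsd (c i)
    exact mem_arc_intCast.2 ⟨y, by omega, by omega, rfl⟩
  · rw [Finset.disjoint_left]
    intro x hxi hxj
    obtain ⟨y, h1, h2, rfl⟩ := mem_arc_intCast.1 hxi
    obtain ⟨z, h3, h4, hzy⟩ := mem_arc_intCast.1 hxj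
    obtain ⟨t, ht⟩ := (ZMod.intCast_eq_intCast_iff_dvd_sub _ _ _).1 hzy
    have h5 := hsper (c j) t
    have h6 : c i = c j + M * t :=
      eq_of_mem_separated_intervals hsep h1 h2 (by omega) (by omega)
    apply hij
    rw [← hc i hi, ← hc j hj, h6, hgper]
end

section
/- Let N, n, t be integers with 0 ≤ t < n ≤ N and N ≥ 2n − t, and let a, b ∈ ZMod N. Then |arc(a, n) ∩ arc(b, n)| ≤ t if and only if, writing d ∈ {0, 1, ..., N−1} for the representative of b − a in ZMod N, both d ≥ n − t and N − d ≥ n − t hold. -/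
theorem mem_arc_iff_val_sub_lt {N m : ℕ} [NeZero N] (hm : m ≤ N) (a x : ZMod N) :
    x ∈ arc N a m ↔ (x - a).val < m := by
  simp only [arc, Finset.mem_image, Finset.mem_range]
  constructor
  · rintro ⟨i, hi, rfl⟩
    rwa [add_sub_cancel_left, ZMod.val_cast_of_lt (hi.trans_le hm)]
  · intro h
    exact ⟨(x - a).val, h, by rw [ZMod.natCast_zmod_val, add_sub_cancel]⟩

theorem val_natCast_sub {N i : ℕ} [NeZero N] (hi : i < N) (d : ZMod N) :
    ((i : ZMod N) - d).val = if d.val ≤ i then i - d.val else N + i - d.val := by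
  have hd := ZMod.val_lt d
  split_ifs with h
  · rw [← ZMod.val_cast_of_lt (show i - d.val < N by omega), Nat.cast_sub h,
      ZMod.natCast_zmod_val]
  · rw [← ZMod.val_cast_of_lt (show N + i - d.val < N by omega),
      Nat.cast_sub (show d.val ≤ N + i by omega), Nat.cast_add, ZMod.natCast_self, zero_add,
      ZMod.natCast_zmod_val]

theorem card_arc_inter_arc {N n : ℕ} [NeZero N] (hn : n ≤ N) (a b : ZMod N) :
    (arc N a n ∩ arc N b n).card = (n - (b - a).val) + ((b - a).val + n - N) := by
  have hd := ZMod.val_lt (b - a)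
  have himage : arc N a n ∩ arc N b n =
      (Finset.Ico (b - a).val n ∪ Finset.range ((b - a).val + n - N)).image
        (fun i : ℕ => a + (i : ZMod N)) := by
    ext x
    obtain ⟨i, hi, rfl⟩ : ∃ i < N, a + (i : ZMod N) = x :=
      ⟨(x - a).val, ZMod.val_lt _, by rw [ZMod.natCast_zmod_val, add_sub_cancel]⟩
    have hmem : a + (i : ZMod N) ∈ arc N a n ∩ arc N b n ↔
        i ∈ Finset.Ico (b - a).val n ∪ Finset.range ((b - a).val + n - N) := by
      rw [Finset.mem_inter, mem_arc_iff_val_sub_lt hn, mem_arc_iff_val_sub_lt hn,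
        add_sub_cancel_left, ZMod.val_cast_of_lt hi,
        show a + (i : ZMod N) - b = i - (b - a) by ring, val_natCast_sub hi]
      simp only [Finset.mem_union, Finset.mem_Ico, Finset.mem_range]
      split_ifs <;> omega
    rw [hmem, Finset.mem_image]
    refine ⟨fun h => ⟨i, h, rfl⟩, ?_⟩
    rintro ⟨j, hj, hji⟩
    have hjN : j < N := by
      simp only [Finset.mem_union, Finset.mem_Ico, Finset.mem_range] at hj
      omega
    have hval := congrArg ZMod.val (add_left_cancel hji)
    rw [ZMod.val_cast_of_lt hjN, ZMod.val_cast_of_lt hi] at hval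
    rwa [← hval]
  rw [himage, Finset.card_image_of_injOn, Finset.card_union_of_disjoint, Nat.card_Ico,
    Finset.card_range]
  · rw [Finset.disjoint_left]
    intro i hi hi'
    simp only [Finset.mem_Ico, Finset.mem_range] at hi hi'
    omega
  · intro i hi j hj hij
    simp only [Finset.coe_union, Finset.coe_Ico, Finset.coe_range, Set.mem_union, Set.mem_Ico,
      Set.mem_Iio] at hi hj
    have hval := congrArg ZMod.val (add_left_cancel hij)
    rwa [ZMod.val_cast_of_lt (by omega), ZMod.val_cast_of_lt (by omega)] at hval

/-- Two length-`n` arcs intersect in at most `t` points exactly when neither start lies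
among the first `n − t` positions of the other arc: with `d` the representative of
`b − a` in `{0, …, N−1}`, the condition is `d ≥ n − t` and `N − d ≥ n − t`. -/
theorem arc_intersection_le_iff
    (N n t : ℕ) (htn : t < n) (hnN : n ≤ N) (hN2 : 2 * n - t ≤ N)
    (a b : ZMod N) :
    ((arc N a n) ∩ (arc N b n)).card ≤ t ↔
      (n - t ≤ (b - a).val ∧ n - t ≤ N - (b - a).val) := by
  have : NeZero N := ⟨by omega⟩
  have hd := ZMod.val_lt (b - a)
  rw [card_arc_inter_arc hnN]
  omega
end
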